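/- arXiv:1706.01227 — 4 statements merged into one kernel-verified Lean document; each statement's English description precedes it below -/
import Mathlib

section
/- Let a ∈ ℚ₂ with ‖a‖ > 1 and suppose there exists b ∈ ℚ₂ with b² = 1 - a. Then for every x ∈ ℚ₂ with ‖x‖ ≠ 1/√‖a‖, the iterates ψ^[n](x) tend to ∞ in OnePoint ℚ₂ (i.e. Tendsto (fun n => ψ^[n] x) atTop (𝓝 ∞)). -/
open Filter Topology OnePoint

open scoped Classical in
/-- The rational map `x ↦ a·x + 1/x` on the projective line `P¹(ℚ₂) = OnePoint ℚ₂`: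
`ψ(∞) = ∞`, `ψ(0) = ∞`, and `ψ(x) = a·x + x⁻¹` for nonzero `x ∈ ℚ₂`. -/
noncomputable def psi (a : ℚ_[2]) : OnePoint ℚ_[2] → OnePoint ℚ_[2] :=
  fun z => OnePoint.rec ∞
    (fun x => if x = 0 then ∞ else ((a * x + x⁻¹ : ℚ_[2]) : OnePoint ℚ_[2])) z

theorem psi_coe (a : ℚ_[2]) {x : ℚ_[2]} (hx : x ≠ 0) :
    psi a x = ((a * x + x⁻¹ : ℚ_[2]) : OnePoint ℚ_[2]) :=
  if_neg hx

theorem psi_zero (a : ℚ_[2]) : psi a ((0 : ℚ_[2]) : OnePoint ℚ_[2]) = ∞ :=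
  if_pos rfl

theorem psi_infty (a : ℚ_[2]) : psi a ∞ = ∞ := rfl

/-- When `1 < ‖a‖ * ‖x‖ ^ 2`, the linear term dominates. -/
theorem norm_mul_add_inv_of_one_lt {a x : ℚ_[2]} (hx : 1 < ‖a‖ * ‖x‖ ^ 2) :
    ‖a * x + x⁻¹‖ = ‖a‖ * ‖x‖ := by
  have hx0 : 0 < ‖x‖ := norm_pos_iff.2 fun h => by norm_num [h] at hx
  have h : ‖x⁻¹‖ < ‖a * x‖ := by
    rw [norm_inv, norm_mul, inv_lt_iff_one_lt_mul₀ hx0]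
    linarith
  rw [Padic.add_eq_max_of_ne h.ne', max_eq_left h.le, norm_mul]

/-- When `‖a‖ * ‖x‖ ^ 2 < 1`, the inverse term dominates. -/
theorem norm_mul_add_inv_of_lt_one {a x : ℚ_[2]} (hx0 : x ≠ 0) (hx : ‖a‖ * ‖x‖ ^ 2 < 1) :
    ‖a * x + x⁻¹‖ = ‖x‖⁻¹ := by
  have h : ‖a * x‖ < ‖x⁻¹‖ := by
    rw [norm_inv, norm_mul, ← one_div, lt_div_iff₀ (norm_pos_iff.2 hx0)]
    linarith
  rw [Padic.add_eq_max_of_ne h.ne, max_eq_right h.le, norm_inv]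

theorem exists_coe_eq_psi_iterate {a x : ℚ_[2]} (ha : 1 < ‖a‖) (hx : 1 < ‖a‖ * ‖x‖ ^ 2) (n : ℕ) :
    ∃ y : ℚ_[2], (psi a)^[n] x = y ∧ ‖y‖ = ‖a‖ ^ n * ‖x‖ := by
  induction n with
  | zero => exact ⟨x, rfl, by simp⟩
  | succ n ih =>
    obtain ⟨y, hy, hn⟩ := ih
    have hy1 : 1 < ‖a‖ * ‖y‖ ^ 2 := by
      refine hx.trans_le ?_
      have : ‖x‖ ≤ ‖y‖ := hn ▸ le_mul_of_one_le_left (norm_nonneg x) (one_le_pow₀ ha.le)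
      gcongr
    have hy0 : y ≠ 0 := fun h => by norm_num [h] at hy1
    refine ⟨a * y + y⁻¹, ?_, ?_⟩
    · rw [Function.iterate_succ_apply', hy, psi_coe a hy0]
    · rw [norm_mul_add_inv_of_one_lt hy1, hn, pow_succ']
      ring

theorem tendsto_psi_iterate_of_one_lt {a x : ℚ_[2]} (ha : 1 < ‖a‖) (hx : 1 < ‖a‖ * ‖x‖ ^ 2) :
    Tendsto (fun n => (psi a)^[n] (x : OnePoint ℚ_[2])) atTop (𝓝 (∞ : OnePoint ℚ_[2])) := by
  choose y hy hn using exists_coe_eq_psi_iterate ha hx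
  have hx0 : 0 < ‖x‖ := norm_pos_iff.2 fun h => by norm_num [h] at hx
  have hc : Tendsto y atTop (coclosedCompact ℚ_[2]) := by
    rw [coclosedCompact_eq_cocompact, ← Metric.cobounded_eq_cocompact,
      ← tendsto_norm_atTop_iff_cobounded]
    simp only [hn]
    exact (tendsto_pow_atTop_atTop_of_one_lt ha).atTop_mul_const hx0
  simp only [hy]
  exact OnePoint.tendsto_coe_infty.comp hc

theorem stmt_4 (a : ℚ_[2]) (ha : 1 < ‖a‖) (hsq : ∃ b : ℚ_[2], b ^ 2 = 1 - a)
    (x : ℚ_[2]) (hx : ‖x‖ ≠ 1 / Real.sqrt ‖a‖) :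
    Tendsto (fun n => (psi a)^[n] (x : OnePoint ℚ_[2])) atTop
      (𝓝 (∞ : OnePoint ℚ_[2])) := by
  have ha0 : 0 < ‖a‖ := one_pos.trans ha
  have hne : ‖a‖ * ‖x‖ ^ 2 ≠ 1 := by
    intro h
    apply hx
    rw [← Real.sqrt_one, ← Real.sqrt_div zero_le_one, eq_comm,
      Real.sqrt_eq_iff_mul_self_eq (by positivity) (norm_nonneg x), ← h]
    field_simp
  rcases hne.lt_or_gt with hlt | hgt
  · rw [← tendsto_add_atTop_iff_nat 1]
    simp only [Function.iterate_succ_apply]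
    rcases eq_or_ne x 0 with rfl | hx0
    · rw [psi_zero]
      simp only [Function.iterate_fixed (psi_infty a)]
      exact tendsto_const_nhds
    · rw [psi_coe a hx0]
      apply tendsto_psi_iterate_of_one_lt ha
      have hpos : 0 < ‖x‖ := norm_pos_iff.2 hx0
      rw [norm_mul_add_inv_of_lt_one hx0 hlt, inv_pow, ← div_eq_mul_inv, one_lt_div (by positivity)]
      nlinarith [sq_nonneg ‖x‖]
  · exact tendsto_psi_iterate_of_one_lt ha hgt
end

section
/- Let a ∈ ℚ₂ with a ≠ 0 and ‖a‖ < 1. (1) If x, y ∈ ℚ₂ satisfy ‖x‖ = ‖y‖ and ‖a‖·‖x‖² > 1, then ‖φ(x) - φ(y)‖ = ‖a‖·‖x - y‖ and ‖φ(x)‖ = ‖a‖·‖x‖. (2) If x, y ∈ ℚ₂ satisfy ‖x‖ = ‖y‖ and 0 < ‖x‖ ≤ 1, then ‖φ(x) - φ(y)‖ = ‖x - y‖ / ‖x‖² and ‖φ(x)‖ = 1/‖x‖. -/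
/-- The rational map `φ(x) = a·x + 1/x` on `ℚ₂` (with the convention `0⁻¹ = 0`). -/
noncomputable def phi (a : ℚ_[2]) (x : ℚ_[2]) : ℚ_[2] := a * x + x⁻¹

theorem norm_phi {a x : ℚ_[2]} (hx : x ≠ 0) (h : ‖a‖ ≠ (‖x‖ ^ 2)⁻¹) :
    ‖phi a x‖ = ‖x‖ * max ‖a‖ (‖x‖ ^ 2)⁻¹ := by
  have hfac : phi a x = x * (a + (x ^ 2)⁻¹) := by
    unfold phi
    field_simp
  have hn : ‖(x ^ 2)⁻¹‖ = (‖x‖ ^ 2)⁻¹ := by rw [norm_inv, norm_pow]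
  rw [hfac, norm_mul, Padic.add_eq_max_of_ne (by rwa [hn]), hn]

theorem norm_phi_sub_phi {a x y : ℚ_[2]} (hx : x ≠ 0) (hxy : ‖x‖ = ‖y‖)
    (h : ‖a‖ ≠ (‖x‖ ^ 2)⁻¹) :
    ‖phi a x - phi a y‖ = ‖x - y‖ * max ‖a‖ (‖x‖ ^ 2)⁻¹ := by
  have hy : y ≠ 0 := norm_ne_zero_iff.1 (hxy ▸ norm_ne_zero_iff.2 hx)
  have hfac : phi a x - phi a y = (x - y) * (a + -(x * y)⁻¹) := by
    unfold phi
    field_simp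
    ring
  have hn : ‖-(x * y)⁻¹‖ = (‖x‖ ^ 2)⁻¹ := by rw [norm_neg, norm_inv, norm_mul, ← hxy, sq]
  rw [hfac, norm_mul, Padic.add_eq_max_of_ne (by rwa [hn]), hn]

theorem stmt_6 (a : ℚ_[2]) (ha0 : a ≠ 0) (ha : ‖a‖ < 1) :
    (∀ x y : ℚ_[2], ‖x‖ = ‖y‖ → 1 < ‖a‖ * ‖x‖ ^ 2 →
      ‖phi a x - phi a y‖ = ‖a‖ * ‖x - y‖ ∧ ‖phi a x‖ = ‖a‖ * ‖x‖) ∧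
    (∀ x y : ℚ_[2], ‖x‖ = ‖y‖ → 0 < ‖x‖ → ‖x‖ ≤ 1 →
      ‖phi a x - phi a y‖ = ‖x - y‖ / ‖x‖ ^ 2 ∧ ‖phi a x‖ = 1 / ‖x‖) := by
  refine ⟨fun x y hxy h => ?_, fun x y hxy h0 h1 => ?_⟩
  · have hx : x ≠ 0 := by
      rintro rfl
      norm_num at h
    have hpos : 0 < ‖x‖ := norm_pos_iff.2 hx
    have hlt : (‖x‖ ^ 2)⁻¹ < ‖a‖ := (inv_lt_iff_one_lt_mul₀ (by positivity)).2 h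
    rw [norm_phi_sub_phi hx hxy hlt.ne', norm_phi hx hlt.ne', max_eq_left hlt.le]
    exact ⟨mul_comm _ _, mul_comm _ _⟩
  · have hx : x ≠ 0 := norm_pos_iff.1 h0
    have hlt : ‖a‖ < (‖x‖ ^ 2)⁻¹ :=
      ha.trans_le ((one_le_inv₀ (by positivity)).2 (pow_le_one₀ h0.le h1))
    rw [norm_phi_sub_phi hx hxy hlt.ne, norm_phi hx hlt.ne, max_eq_right hlt.le]
    exact ⟨(div_eq_mul_inv _ _).symm, by field_simp⟩
end

section
/- Let a ∈ ℚ₂ with a ≠ 0 and ‖a‖ < 1, and suppose b ∈ ℚ₂ satisfies b² = -a. Then for all x, y lying in closedBall(1/b, 1/(4·√‖a‖)) (or both lying in closedBall(-1/b, 1/(4·√‖a‖))), one has ‖φ(x) - φ(y)‖ = (‖a‖/2)·‖x - y‖; moreover φ '' closedBall(1/b, 1/(4·√‖a‖)) = φ '' closedBall(-1/b, 1/(4·√‖a‖)) = closedBall(0, √‖a‖/8). -/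
open Metric Set

lemma sqrt_norm_eq_of_sq_eq_neg {a b : ℚ_[2]} (hb : b ^ 2 = -a) : Real.sqrt ‖a‖ = ‖b‖ := by
  rw [← norm_neg a, ← hb, norm_pow, Real.sqrt_sq (norm_nonneg b)]

lemma norm_two_padic : ‖(2 : ℚ_[2])‖ = 1 / 2 := by
  simpa using Padic.norm_p (p := 2)

lemma padic_norm_two_add {u : ℚ_[2]} (hu : ‖u‖ ≤ 1 / 4) : ‖2 + u‖ = 1 / 2 := by
  rw [Padic.add_eq_max_of_ne (by rw [norm_two_padic]; linarith), norm_two_padic,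
    max_eq_left (by linarith)]

lemma padic_norm_one_add {u : ℚ_[2]} (hu : ‖u‖ ≤ 1 / 4) : ‖1 + u‖ = 1 := by
  rw [Padic.add_eq_max_of_ne (by rw [norm_one]; linarith), norm_one,
    max_eq_left (by linarith)]

lemma mem_closedBall_one_div_iff {b x : ℚ_[2]} (hb0 : b ≠ 0) :
    x ∈ closedBall (1 / b) (1 / (4 * ‖b‖)) ↔ ‖b * x - 1‖ ≤ 1 / 4 := by
  have hpos : 0 < ‖b‖ := norm_pos_iff.2 hb0
  have h : b * x - 1 = b * (x - 1 / b) := by field_simp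
  rw [mem_closedBall, dist_eq_norm, h, norm_mul, le_div_iff₀ (by positivity)]
  constructor <;> intro h <;> linarith

lemma norm_phi_sub_phi_s9 {a b x y : ℚ_[2]} (hb0 : b ≠ 0) (hb : b ^ 2 = -a)
    (hx : x ∈ closedBall (1 / b) (1 / (4 * ‖b‖)))
    (hy : y ∈ closedBall (1 / b) (1 / (4 * ‖b‖))) :
    ‖phi a x - phi a y‖ = ‖a‖ / 2 * ‖x - y‖ := by
  rw [mem_closedBall_one_div_iff hb0] at hx hy
  have hs := padic_norm_one_add hx
  have ht := padic_norm_one_add hy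
  rw [add_sub_cancel] at hs ht
  have hx0 : x ≠ 0 := by rintro rfl; simp at hs
  have hy0 : y ≠ 0 := by rintro rfl; simp at ht
  have hu : ‖(b * x - 1) + b * x * (b * y - 1)‖ ≤ 1 / 4 := by
    refine (Padic.nonarchimedean _ _).trans (max_le hx ?_)
    rw [norm_mul, hs, one_mul]
    exact hy
  have h2 := padic_norm_two_add hu
  obtain rfl : a = -b ^ 2 := by rw [hb, neg_neg]
  have key : phi (-b ^ 2) x - phi (-b ^ 2) y =
      -b ^ 2 * (x - y) * (2 + ((b * x - 1) + b * x * (b * y - 1))) / (b * x * (b * y)) := by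
    unfold phi
    field_simp
    ring
  rw [key, norm_div, norm_mul, norm_mul, norm_mul (b * x), hs, ht, h2]
  ring

lemma exists_padic_root {w : ℚ_[2]} (hw : ‖w‖ ≤ 1 / 8) :
    ∃ t : ℚ_[2], ‖t - 1‖ ≤ 1 / 4 ∧ t ^ 2 + w * t - 1 = 0 := by
  let W : ℤ_[2] := ⟨w, hw.trans (by norm_num)⟩
  let F : Polynomial ℤ_[2] := Polynomial.X ^ 2 + Polynomial.C W * Polynomial.X - 1
  have hF (z : ℤ_[2]) : F.aeval z = z ^ 2 + W * z - 1 := by simp [F]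
  have hF' : F.derivative.aeval (1 : ℤ_[2]) = 2 + W := by
    simp [F, one_add_one_eq_two]
  have hn : ‖(2 + W : ℤ_[2])‖ = 1 / 2 := by
    rw [PadicInt.norm_def]
    exact padic_norm_two_add (hw.trans (by norm_num))
  obtain ⟨z, hz, hz1, -⟩ := hensels_lemma (F := F) (a := (1 : ℤ_[2])) (by
    rw [hF, hF', hn, one_pow, mul_one, add_sub_cancel_left]
    exact lt_of_le_of_lt hw (by norm_num))
  rw [hF', hn] at hz1
  rw [hF] at hz
  refine ⟨z, ?_, by exact_mod_cast congrArg ((↑) : ℤ_[2] → ℚ_[2]) hz⟩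
  have := (PadicInt.norm_le_pow_iff_norm_lt_pow_add_one (z - 1) (-2)).2 (by norm_num at hz1 ⊢; exact hz1)
  rw [PadicInt.norm_def] at this
  norm_num at this ⊢
  exact this

lemma phi_image_closedBall {a b : ℚ_[2]} (hb0 : b ≠ 0) (hb : b ^ 2 = -a) :
    phi a '' closedBall (1 / b) (1 / (4 * ‖b‖)) = closedBall 0 (‖b‖ / 8) := by
  have hpos : 0 < ‖b‖ := norm_pos_iff.2 hb0
  have hna : ‖a‖ = ‖b‖ ^ 2 := by rw [← norm_pow, hb, norm_neg]
  have hphi0 : phi a (1 / b) = 0 := by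
    obtain rfl : a = -b ^ 2 := by rw [hb, neg_neg]
    unfold phi
    field_simp
    ring
  ext z
  rw [mem_closedBall_zero_iff]
  constructor
  · rintro ⟨x, hx, rfl⟩
    have h := norm_phi_sub_phi_s9 hb0 hb hx (mem_closedBall_self (by positivity))
    rw [hphi0, sub_zero] at h
    rw [mem_closedBall, dist_eq_norm] at hx
    calc ‖phi a x‖ = ‖a‖ / 2 * ‖x - 1 / b‖ := h
      _ ≤ ‖a‖ / 2 * (1 / (4 * ‖b‖)) := by gcongr
      _ = ‖b‖ / 8 := by rw [hna]; field_simp; norm_num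
  · intro hz
    obtain ⟨t, ht, hroot⟩ := exists_padic_root (w := z / b) (by
      rw [norm_div, div_le_iff₀ hpos]
      linarith)
    have ht0 : t ≠ 0 := by rintro rfl; simp at hroot
    refine ⟨t / b, ?_, ?_⟩
    · rwa [mem_closedBall_one_div_iff hb0, mul_div_cancel₀ _ hb0]
    · obtain rfl : a = -b ^ 2 := by rw [hb, neg_neg]
      unfold phi
      field_simp at hroot ⊢
      linear_combination -hroot


theorem stmt_9 (a b : ℚ_[2]) (ha0 : a ≠ 0) (ha : ‖a‖ < 1) (hb : b ^ 2 = -a) :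
    (∀ x y : ℚ_[2],
      ((x ∈ closedBall (1 / b) (1 / (4 * Real.sqrt ‖a‖)) ∧
        y ∈ closedBall (1 / b) (1 / (4 * Real.sqrt ‖a‖))) ∨
       (x ∈ closedBall (-(1 / b)) (1 / (4 * Real.sqrt ‖a‖)) ∧
        y ∈ closedBall (-(1 / b)) (1 / (4 * Real.sqrt ‖a‖)))) →
      ‖phi a x - phi a y‖ = ‖a‖ / 2 * ‖x - y‖) ∧
    phi a '' closedBall (1 / b) (1 / (4 * Real.sqrt ‖a‖)) =
      closedBall 0 (Real.sqrt ‖a‖ / 8) ∧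
    phi a '' closedBall (-(1 / b)) (1 / (4 * Real.sqrt ‖a‖)) =
      closedBall 0 (Real.sqrt ‖a‖ / 8) := by
  have hb0 : b ≠ 0 := by
    rintro rfl
    exact ha0 (by simpa using hb.symm)
  have hneg : -(1 / b) = 1 / -b := by rw [div_neg]
  have hb' : (-b) ^ 2 = -a := by rw [neg_sq, hb]
  rw [sqrt_norm_eq_of_sq_eq_neg hb, hneg]
  have hball : ∀ c : ℚ_[2], closedBall c (1 / (4 * ‖b‖)) = closedBall c (1 / (4 * ‖-b‖)) := by
    simp
  refine ⟨?_, phi_image_closedBall hb0 hb, ?_⟩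
  · rintro x y (⟨hx, hy⟩ | ⟨hx, hy⟩)
    · exact norm_phi_sub_phi_s9 hb0 hb hx hy
    · rw [hball] at hx hy
      exact norm_phi_sub_phi_s9 (neg_ne_zero.2 hb0) hb' hx hy
  · simpa only [norm_neg] using phi_image_closedBall (neg_ne_zero.2 hb0) hb'
end

section
/- Let a ∈ ℚ₂ with a ≠ 0 and ‖a‖ = 2^(-2m) for an integer m ≥ 1, and suppose that there is no b ∈ ℚ₂ with b² = -a and no c ∈ ℚ₂ with a = 3·c² (equivalently, √(-a) ∉ ℚ₂(√(-3))). Then every x ∈ ℚ₂ with ‖x‖ = 2^m satisfies ‖φ(x)‖ = 2^(-(m+1)), i.e. φ maps the sphere S(0, 1/√‖a‖) into the sphere S(0, √‖a‖/2). -/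
theorem PadicInt.norm_two_eq_half : ‖(2 : ℤ_[2])‖ = 1 / 2 := by
  simpa using PadicInt.norm_p (p := 2)

theorem PadicInt.exists_sq_eq_one_add_eight_mul (t : ℤ_[2]) :
    ∃ z : ℤ_[2], z ^ 2 = 1 + 8 * t := by
  have h8 : ‖(8 : ℤ_[2])‖ = 1 / 8 := by
    rw [show (8 : ℤ_[2]) = 2 ^ 3 by norm_num, norm_pow, norm_two_eq_half]
    norm_num
  have key : ‖(Polynomial.X ^ 2 - Polynomial.C (1 + 8 * t)).aeval (1 : ℤ_[2])‖ <
      ‖(Polynomial.X ^ 2 - Polynomial.C (1 + 8 * t)).derivative.aeval (1 : ℤ_[2])‖ ^ 2 := by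
    simp only [map_sub, map_pow, Polynomial.aeval_X, Polynomial.aeval_C, Algebra.algebraMap_self,
      RingHom.id_apply, Polynomial.derivative_X_pow,
      Polynomial.derivative_C, map_mul, map_zero]
    have h1 : (1 : ℤ_[2]) ^ 2 - (1 + 8 * t) = -(8 * t) := by ring
    rw [h1, norm_neg, norm_mul, h8]
    norm_num [norm_two_eq_half]
    linarith [t.norm_le_one]
  obtain ⟨z, hz, -⟩ := hensels_lemma key
  refine ⟨z, ?_⟩
  simpa [sub_eq_zero] using hz

theorem PadicInt.exists_eq_natCast_add_eight_mul (u : ℤ_[2]) :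
    ∃ n : ℕ, n < 8 ∧ ∃ t : ℤ_[2], u = (n : ℤ_[2]) + 8 * t := by
  obtain ⟨t, ht⟩ := Ideal.mem_span_singleton.1 (PadicInt.appr_spec 3 u)
  refine ⟨u.appr 3, by simpa using PadicInt.appr_lt u 3, t, ?_⟩
  push_cast at ht
  linear_combination ht

theorem PadicInt.norm_two_mul_lt_one (t : ℤ_[2]) : ‖2 * t‖ < 1 := by
  rw [norm_mul, norm_two_eq_half]
  linarith [t.norm_le_one]

theorem PadicInt.norm_one_add_two_mul (t : ℤ_[2]) : ‖1 + 2 * t‖ = 1 := by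
  have h := norm_two_mul_lt_one t
  rw [IsUltrametricDist.norm_add_eq_max_of_norm_ne_norm (by rw [norm_one]; exact h.ne'), norm_one]
  exact max_eq_left h.le

/-- A 2-adic unit `u` is minus a square, three times a square, or congruent to `1` modulo `4`;
in the last case `‖u + 1‖ = 1 / 2`. -/
theorem PadicInt.unit_trichotomy (u : ℤ_[2]) (hu : ‖u‖ = 1) :
    (∃ z : ℤ_[2], z ^ 2 = -u) ∨ (∃ z : ℤ_[2], z ^ 2 = 3 * u) ∨ ‖u + 1‖ = 1 / 2 := by
  obtain ⟨n, hn, t, rfl⟩ := exists_eq_natCast_add_eight_mul u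
  have not_even (s : ℤ_[2]) (h : (n : ℤ_[2]) + 8 * t = 2 * s) : False :=
    (norm_two_mul_lt_one s).ne (h ▸ hu)
  have norm_eq (s : ℤ_[2]) (h : (n : ℤ_[2]) + 8 * t + 1 = 2 * (1 + 2 * s)) :
      ‖(n : ℤ_[2]) + 8 * t + 1‖ = 1 / 2 := by
    rw [h, norm_mul, norm_one_add_two_mul, norm_two_eq_half, mul_one]
  interval_cases n
  · exact (not_even (4 * t) (by push_cast; ring)).elim
  · exact .inr (.inr (norm_eq (2 * t) (by push_cast; ring)))
  · exact (not_even (1 + 4 * t) (by push_cast; ring)).elim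
  · obtain ⟨z, hz⟩ := exists_sq_eq_one_add_eight_mul (1 + 3 * t)
    exact .inr (.inl ⟨z, by rw [hz]; push_cast; ring⟩)
  · exact (not_even (2 + 4 * t) (by push_cast; ring)).elim
  · exact .inr (.inr (norm_eq (1 + 2 * t) (by push_cast; ring)))
  · exact (not_even (3 + 4 * t) (by push_cast; ring)).elim
  · obtain ⟨z, hz⟩ := exists_sq_eq_one_add_eight_mul (-1 - t)
    exact .inl ⟨z, by rw [hz]; push_cast; ring⟩

theorem stmt_10 (a : ℚ_[2]) (ha0 : a ≠ 0) (m : ℤ) (hm : 1 ≤ m)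
    (ha : ‖a‖ = (2 : ℝ) ^ (-(2 * m)))
    (hsq : ¬ ∃ b : ℚ_[2], b ^ 2 = -a) (hsq3 : ¬ ∃ c : ℚ_[2], a = 3 * c ^ 2)
    (x : ℚ_[2]) (hx : ‖x‖ = (2 : ℝ) ^ m) :
    ‖phi a x‖ = (2 : ℝ) ^ (-(m + 1)) := by
  have hx0 : x ≠ 0 := by
    rw [← norm_ne_zero_iff, hx]
    positivity
  have hu : ‖a * x ^ 2‖ = 1 := by
    rw [norm_mul, norm_pow, ha, hx, ← zpow_natCast, ← zpow_mul, ← zpow_add₀ two_ne_zero]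
    convert zpow_zero (2 : ℝ) using 2
    push_cast
    ring
  rcases PadicInt.unit_trichotomy ⟨a * x ^ 2, hu.le⟩ hu with ⟨z, hz⟩ | ⟨z, hz⟩ | h
  · refine (hsq ⟨z / x, ?_⟩).elim
    have hz' : (z : ℚ_[2]) ^ 2 = -(a * x ^ 2) := by exact_mod_cast congrArg Subtype.val hz
    rw [div_pow, hz']
    field_simp
  · refine (hsq3 ⟨z / (3 * x), ?_⟩).elim
    have hz' : (z : ℚ_[2]) ^ 2 = 3 * (a * x ^ 2) := by exact_mod_cast congrArg Subtype.val hz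
    rw [div_pow, hz']
    field_simp
  · have h' : ‖a * x ^ 2 + 1‖ = 1 / 2 := h
    have hphi : phi a x = (a * x ^ 2 + 1) * x⁻¹ := by
      unfold phi
      field_simp
    rw [hphi, norm_mul, h', norm_inv, hx, neg_add, zpow_add₀ two_ne_zero, zpow_neg, zpow_neg_one]
    ring
end
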